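/- Assume s₀ ≥ 1 and define, for n ≥ 1, the probability measure ν_n on {0, 1, …, n−s₀} by ν_n({k}) := b·(k/n)·P(I_n = k) + (s₀/n)·1{k = n−s₀}. Then there exist ε > 0, K > 0 and n₀ ∈ ℕ such that for all n ≥ n₀ and all m ∈ ℕ with e^{−K}·n ≤ m ≤ n, Σ_{k≥0} min{ν_n({k}), ν_m({k})} ≥ ε; equivalently, the total variation distance Σ_k |ν_n({k}) − ν_m({k})| is at most 2(1−ε). -/

import Mathlib

open MeasureTheory Filter Topology Asymptotics

/-- Bernstein basis polynomial, evaluated. -/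
noncomputable def bB (N k : ℕ) (x : ℝ) : ℝ := (bernsteinPolynomial ℝ N k).eval x

lemma bB_eq (N k : ℕ) (x : ℝ) : bB N k x = (N.choose k : ℝ) * x ^ k * (1 - x) ^ (N - k) := by
  simp [bB, bernsteinPolynomial]

lemma bB_cont (N k : ℕ) : Continuous (bB N k) := by
  unfold bB; fun_prop

lemma bB_nonneg (N k : ℕ) {x : ℝ} (hx : x ∈ Set.Icc (0:ℝ) 1) : 0 ≤ bB N k x := by
  rw [bB_eq]
  have h1 := hx.1
  have h2 : 0 ≤ 1 - x := by linarith [hx.2]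
  positivity

lemma bB_sum (N : ℕ) (x : ℝ) : ∑ k ∈ Finset.range (N + 1), bB N k x = 1 := by
  have := congrArg (Polynomial.eval x) (bernsteinPolynomial.sum ℝ N)
  simpa [Polynomial.eval_finsetSum, bB] using this

lemma bB_mean (N : ℕ) (x : ℝ) : ∑ k ∈ Finset.range (N + 1), (k:ℝ) * bB N k x = N * x := by
  have := congrArg (Polynomial.eval x) (bernsteinPolynomial.sum_smul ℝ N)
  simpa [Polynomial.eval_finsetSum, bB] using this

lemma bB_var (N : ℕ) (x : ℝ) :
    ∑ k ∈ Finset.range (N + 1), (N * x - (k:ℝ)) ^ 2 * bB N k x = N * x * (1 - x) := by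
  have := congrArg (Polynomial.eval x) (bernsteinPolynomial.variance ℝ N)
  simpa [Polynomial.eval_finsetSum, bB] using this

lemma bB_le_one (N k : ℕ) {x : ℝ} (hx : x ∈ Set.Icc (0:ℝ) 1) : bB N k x ≤ 1 := by
  by_cases hk : k ∈ Finset.range (N + 1)
  · rw [← bB_sum N x]
    exact Finset.single_le_sum (f := fun k => bB N k x) (fun i _ => bB_nonneg N i hx) hk
  · have : N < k := by simpa [Nat.lt_succ_iff] using hk
    simp [bB_eq, Nat.choose_eq_zero_of_lt this]

lemma bB_integral_step (N k : ℕ) :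
    (∫ x in (0:ℝ)..1, bB N k x) - (∫ x in (0:ℝ)..1, bB N (k+1) x) =
      (if k = N then 1 else 0) / (N + 1 : ℝ) := by
  rw [← intervalIntegral.integral_sub ((bB_cont N k).intervalIntegrable _ _)
    ((bB_cont N (k+1)).intervalIntegrable _ _)]
  have hd : ∀ x ∈ Set.uIcc (0:ℝ) 1, HasDerivAt (fun x => bB (N+1) (k+1) x / (N + 1 : ℝ))
      (bB N k x - bB N (k+1) x) x := by
    intro x _
    have h := ((bernsteinPolynomial ℝ (N+1) (k+1)).hasDerivAt x).div_const (N + 1 : ℝ)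
    rw [bernsteinPolynomial.derivative_succ] at h
    refine h.congr_deriv ?_
    have : (N + 1 : ℝ) ≠ 0 := by positivity
    simp [bB]
    field_simp
  rw [intervalIntegral.integral_eq_sub_of_hasDerivAt hd
    (((bB_cont N k).sub (bB_cont N (k+1))).intervalIntegrable _ _)]
  simp [bB, bernsteinPolynomial.eval_at_0, bernsteinPolynomial.eval_at_1]

lemma bB_integral' (N : ℕ) : ∀ j ≤ N, (∫ x in (0:ℝ)..1, bB N (N - j) x) = 1 / (N + 1 : ℝ) := by
  intro j
  induction j with
  | zero =>
    intro _
    have h := bB_integral_step N N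
    have h2 : ∀ x, bB N (N+1) x = 0 := by intro x; simp [bB_eq]
    simpa [h2] using h
  | succ j ih =>
    intro hj
    have h := bB_integral_step N (N - (j+1))
    rw [show N - (j+1) + 1 = N - j by omega, ih (by omega), if_neg (by omega)] at h
    rw [zero_div] at h
    linarith

/-- Lebesgue measure on the unit interval. -/
noncomputable def uL : Measure ℝ := (volume : Measure ℝ).restrict (Set.Icc 0 1)

instance : IsProbabilityMeasure uL := ⟨by simp [uL]⟩

lemma uL_mem : ∀ᵐ x ∂uL, x ∈ Set.Icc (0:ℝ) 1 := ae_restrict_mem measurableSet_Icc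

lemma bB_integral (N k : ℕ) (hk : k ≤ N) : (∫ x, bB N k x ∂uL) = 1 / (N + 1 : ℝ) := by
  have h := bB_integral' N (N - k) (by omega)
  rw [show N - (N - k) = k by omega, intervalIntegral.integral_of_le (by norm_num),
    ← integral_Icc_eq_integral_Ioc] at h
  exact h

lemma bB_mul_integrable (N k : ℕ) {μ : Measure ℝ} (hμ : ∀ᵐ x ∂μ, x ∈ Set.Icc (0:ℝ) 1)
    {h : ℝ → ℝ} (hh : Integrable h μ) : Integrable (fun x => bB N k x * h x) μ := by
  refine hh.bdd_mul (c := 1) (bB_cont N k).aestronglyMeasurable ?_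
  filter_upwards [hμ] with x hx
  rw [Real.norm_eq_abs, abs_of_nonneg (bB_nonneg N k hx)]
  exact bB_le_one N k hx

lemma lemA (N : ℕ) {h : ℝ → ℝ} (hh : Integrable h uL) :
    ∑ k ∈ Finset.range (N + 1), |∫ x, bB N k x * h x ∂uL| ≤ ∫ x, |h x| ∂uL := by
  calc _ ≤ ∑ k ∈ Finset.range (N + 1), ∫ x, bB N k x * |h x| ∂uL := by
        refine Finset.sum_le_sum fun k _ => ?_
        refine (abs_integral_le_integral_abs).trans (le_of_eq ?_)
        refine integral_congr_ae ?_
        filter_upwards [uL_mem] with x hx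
        simp only [abs_mul, abs_of_nonneg (bB_nonneg N k hx)]
    _ = ∫ x, ∑ k ∈ Finset.range (N + 1), bB N k x * |h x| ∂uL :=
        (integral_finsetSum _ fun k _ => bB_mul_integrable N k uL_mem hh.abs).symm
    _ = _ := by simp_rw [← Finset.sum_mul, bB_sum, one_mul]

lemma lemB {g : ℝ → ℝ} (hg : Continuous g) {C : ℝ} (hC : ∀ x, |g x| ≤ C)
    (huc : UniformContinuous g) {ε : ℝ} (hε : 0 < ε) :
    ∃ N₀ : ℕ, ∀ N ≥ N₀, ∑ k ∈ Finset.range (N + 1),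
      |(∫ x, bB N k x * g x ∂uL) - g (k / N) / (N + 1)| ≤ ε := by
  obtain ⟨δ, hδ, hgδ⟩ := Metric.uniformContinuous_iff.1 huc (ε/2) (half_pos hε)
  have hC0 : 0 ≤ C := (abs_nonneg _).trans (hC 0)
  obtain ⟨N₀, hN₀⟩ := exists_nat_gt (2 * C / δ ^ 2 / (ε / 2))
  refine ⟨N₀ + 1, fun N hN => ?_⟩
  have hNpos : (0:ℝ) < N := by exact_mod_cast (by omega : 0 < N)
  have hNbig : 2 * C / δ ^ 2 / N ≤ ε / 2 := by
    have h1 : 2 * C / δ ^ 2 / (ε / 2) ≤ N := hN₀.le.trans (by exact_mod_cast (by omega : N₀ ≤ N))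
    rw [div_le_iff₀ (by positivity)] at h1 ⊢
    linarith
  have hpt : ∀ x y : ℝ, |g x - g y| ≤ ε / 2 + 2 * C / δ ^ 2 * (x - y) ^ 2 := by
    intro x y
    by_cases hxy : dist x y < δ
    · have := hgδ hxy
      rw [Real.dist_eq] at this
      have : 0 ≤ 2 * C / δ ^ 2 * (x - y) ^ 2 := by positivity
      linarith
    · have h1 : δ ^ 2 ≤ (x - y) ^ 2 := by
        rw [← sq_abs (x - y), ← Real.dist_eq]
        exact pow_le_pow_left₀ hδ.le (not_lt.1 hxy) 2
      have h2 : 2 * C ≤ 2 * C / δ ^ 2 * (x - y) ^ 2 := by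
        rw [div_mul_eq_mul_div, le_div_iff₀ (by positivity)]
        exact mul_le_mul_of_nonneg_left h1 (by positivity)
      have h3 := abs_sub (g x) (g y)
      linarith [hC x, hC y]
  have hgi : Integrable g uL := Integrable.of_bound hg.aestronglyMeasurable C
    (Eventually.of_forall fun x => hC x)
  have hii : ∀ k : ℕ, Integrable (fun x => g x - g (k / N)) uL := fun k =>
    hgi.sub (integrable_const _)
  have hone : Integrable (fun _ : ℝ => (1:ℝ)) uL := integrable_const _
  calc _ ≤ ∑ k ∈ Finset.range (N + 1), ∫ x, bB N k x * |g x - g (k / N)| ∂uL := by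
        refine Finset.sum_le_sum fun k hk => ?_
        have hk' : k ≤ N := by simpa [Nat.lt_succ_iff] using hk
        have : (∫ x, bB N k x * g x ∂uL) - g (k / N) / (N + 1)
            = ∫ x, bB N k x * (g x - g (k / N)) ∂uL := by
          have e : g (k / N) / (N + 1) = ∫ x, bB N k x * g (k / N) ∂uL := by
            rw [integral_mul_const, bB_integral N k hk']; ring
          rw [e, ← integral_sub (bB_mul_integrable N k uL_mem hgi)
            (bB_mul_integrable N k uL_mem (integrable_const _))]
          simp_rw [mul_sub]
        rw [this]
        refine (abs_integral_le_integral_abs).trans (le_of_eq ?_)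
        refine integral_congr_ae ?_
        filter_upwards [uL_mem] with x hx
        simp only [abs_mul, abs_of_nonneg (bB_nonneg N k hx)]
    _ = ∫ x, ∑ k ∈ Finset.range (N + 1), bB N k x * |g x - g (k / N)| ∂uL :=
        (integral_finsetSum _ fun k _ => bB_mul_integrable N k uL_mem (hii k).abs).symm
    _ ≤ ∫ x, ε ∂uL := by
        refine integral_mono_ae
          (integrable_finsetSum _ fun k _ => bB_mul_integrable N k uL_mem (hii k).abs)
          (integrable_const _) ?_
        filter_upwards [uL_mem] with x hx
        have hv : ∑ k ∈ Finset.range (N + 1), (x - (k:ℝ) / N) ^ 2 * bB N k x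
            = x * (1 - x) / N := by
          have := bB_var N x
          have e : ∀ k : ℕ, (x - (k:ℝ) / N) ^ 2 * bB N k x
              = ((N * x - (k:ℝ)) ^ 2 * bB N k x) / N ^ 2 := by
            intro k; field_simp
          simp_rw [e, ← Finset.sum_div, this]
          field_simp
        calc _ ≤ ∑ k ∈ Finset.range (N + 1), (ε / 2 * bB N k x
                + 2 * C / δ ^ 2 * ((x - (k:ℝ) / N) ^ 2 * bB N k x)) := by
              refine Finset.sum_le_sum fun k _ => ?_
              have := mul_le_mul_of_nonneg_left (hpt x (k / N)) (bB_nonneg N k hx)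
              linarith
          _ = ε / 2 + 2 * C / δ ^ 2 * (x * (1 - x) / N) := by
              rw [Finset.sum_add_distrib, ← Finset.mul_sum, ← Finset.mul_sum, bB_sum, hv, mul_one]
          _ ≤ ε / 2 + 2 * C / δ ^ 2 / N := by
              have h1 : x * (1 - x) ≤ 1 := by nlinarith [hx.1, hx.2]
              have : 2 * C / δ ^ 2 * (x * (1 - x) / N) ≤ 2 * C / δ ^ 2 * (1 / N) := by
                gcongr
              linarith [this, (by ring : 2 * C / δ ^ 2 * (1 / N) = 2 * C / δ ^ 2 / N)]
          _ ≤ ε := by linarith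
    _ = ε := by simp

lemma lemC {g : ℝ → ℝ} {C : ℝ} (hC : ∀ x, |g x| ≤ C)
    (huc : UniformContinuous g) {ε : ℝ} (hε : 0 < ε) :
    ∃ δ : ℝ, 0 < δ ∧ ∀ M N : ℕ, 1 ≤ M → M ≤ N → (N:ℝ) - M ≤ δ * N →
      ∑ k ∈ Finset.range (M + 1), |g (k / N) / (N + 1) - g (k / M) / (M + 1)| ≤ ε := by
  obtain ⟨δ, hδ, hgδ⟩ := Metric.uniformContinuous_iff.1 huc (ε/2) (half_pos hε)
  have hC0 : 0 ≤ C := (abs_nonneg _).trans (hC 0)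
  refine ⟨min (δ / 2) (ε / 2 / (C + 1)), by positivity, fun M N hM hMN hd => ?_⟩
  have hM' : (1:ℝ) ≤ M := by exact_mod_cast hM
  have hMN' : (M:ℝ) ≤ N := by exact_mod_cast hMN
  have hN0 : (0:ℝ) < N := by linarith
  have hd1 : ((N:ℝ) - M) ≤ δ / 2 * N := hd.trans (by gcongr; exact min_le_left _ _)
  have hd2 : ((N:ℝ) - M) ≤ ε / 2 / (C + 1) * N := hd.trans (by gcongr; exact min_le_right _ _)
  have key : ∀ k ∈ Finset.range (M + 1),
      |g (k / N) / (N + 1) - g (k / M) / (M + 1)| ≤ ε / (M + 1) := by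
    intro k hk
    have hk' : (k:ℝ) ≤ M := by exact_mod_cast (by simpa [Nat.lt_succ_iff] using hk : k ≤ M)
    have hdist : dist ((k:ℝ) / N) (k / M) < δ := by
      rw [Real.dist_eq, abs_sub_comm, abs_of_nonneg (sub_nonneg.2 (by gcongr))]
      have : (k:ℝ) / M - k / N = (k / M) * ((N - M) / N) := by field_simp
      rw [this]
      have h1 : (k:ℝ) / M ≤ 1 := by rw [div_le_one (by linarith)]; exact hk'
      have h2 : ((N:ℝ) - M) / N ≤ δ / 2 := by rw [div_le_iff₀ hN0]; exact hd1
      have h3 : 0 ≤ ((N:ℝ) - M) / N := div_nonneg (by linarith) hN0.le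
      nlinarith
    have h1 := hgδ hdist
    rw [Real.dist_eq] at h1
    have e : g (k / N) / (N + 1) - g (k / M) / (M + 1)
        = ((g (k / N) - g (k / M)) - g (k / N) * ((N - M) / (N + 1))) / (M + 1) := by
      field_simp; ring
    rw [e, abs_div, abs_of_pos (by positivity : (0:ℝ) < M + 1)]
    gcongr
    refine (abs_sub _ _).trans ?_
    rw [abs_mul, abs_of_nonneg (div_nonneg (by linarith) (by linarith) : 0 ≤ ((N:ℝ) - M) / (N + 1))]
    have h2 : ((N:ℝ) - M) / (N + 1) ≤ ε / 2 / (C + 1) := by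
      rw [div_le_iff₀ (by positivity)]
      refine hd2.trans ?_
      gcongr; linarith
    have h3 : |g (k / N)| * (((N:ℝ) - M) / (N + 1)) ≤ (C + 1) * (ε / 2 / (C + 1)) := by
      apply mul_le_mul _ h2 (div_nonneg (by linarith) (by linarith)) (by linarith)
      linarith [hC ((k:ℝ) / N)]
    have h4 : (C + 1) * (ε / 2 / (C + 1)) = ε / 2 := by field_simp
    linarith
  refine (Finset.sum_le_sum key).trans (le_of_eq ?_)
  rw [Finset.sum_const, Finset.card_range, nsmul_eq_mul]
  push_cast
  field_simp

lemma core (μ : Measure ℝ) [IsProbabilityMeasure μ] (hμ : ∀ᵐ x ∂μ, x ∈ Set.Icc (0:ℝ) 1)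
    (hac : μ ≪ (volume : Measure ℝ)) {ε : ℝ} (hε : 0 < ε) :
    ∃ δ : ℝ, 0 < δ ∧ ∃ N₀ : ℕ, ∀ M N : ℕ, N₀ ≤ M → M ≤ N → (N:ℝ) - M ≤ δ * N →
      ∑ k ∈ Finset.range (M + 1), |(∫ x, bB N k x ∂μ) - ∫ x, bB M k x ∂μ| ≤ ε := by
  have hac' : μ ≪ uL := by
    have : μ.restrict (Set.Icc 0 1) = μ := Measure.restrict_eq_self_of_ae_mem hμ
    rw [← this]
    exact hac.restrict _
  set f : ℝ → ℝ := fun x => (μ.rnDeriv uL x).toReal with hf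
  have hfi : Integrable f uL := Measure.integrable_toReal_rnDeriv
  have hfe : ∀ N k, (∫ x, bB N k x ∂μ) = ∫ x, bB N k x * f x ∂uL := by
    intro N k
    rw [← integral_rnDeriv_smul hac']
    simp only [smul_eq_mul, hf, mul_comm]
  have : uL.Regular := by unfold uL; infer_instance
  obtain ⟨g, hgs, hfg, hgc, hgi⟩ := hfi.exists_hasCompactSupport_integral_sub_le
    (show 0 < ε / 5 by positivity)
  obtain ⟨C, hC⟩ := hgs.exists_bound_of_continuous hgc
  have huc : UniformContinuous g := hgs.uniformContinuous_of_continuous hgc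
  obtain ⟨N₀, hB⟩ := lemB hgc hC huc (show 0 < ε / 5 by positivity)
  obtain ⟨δ, hδ, hCC⟩ := lemC hC huc (show 0 < ε / 5 by positivity)
  refine ⟨δ, hδ, N₀ + 1, fun M N hM hMN hd => ?_⟩
  have hA : ∀ N, ∑ k ∈ Finset.range (N + 1),
      |(∫ x, bB N k x ∂μ) - ∫ x, bB N k x * g x ∂uL| ≤ ε / 5 := by
    intro N
    refine le_trans (le_of_eq ?_) ((lemA N (hfi.sub hgi)).trans hfg)
    refine Finset.sum_congr rfl fun k _ => ?_
    rw [hfe, ← integral_sub (bB_mul_integrable N k uL_mem hfi) (bB_mul_integrable N k uL_mem hgi)]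
    simp_rw [← mul_sub, Pi.sub_apply]
  have hsub : Finset.range (M + 1) ⊆ Finset.range (N + 1) :=
    Finset.range_subset_range.2 (by omega)
  have a1 := (Finset.sum_le_sum_of_subset_of_nonneg hsub (fun _ _ _ => abs_nonneg _)).trans (hA N)
  have a2 := hA M
  have a3 := (Finset.sum_le_sum_of_subset_of_nonneg hsub (fun _ _ _ => abs_nonneg _)).trans
    (hB N (by omega))
  have a4 := hB M (by omega)
  have a5 := hCC M N (by omega) hMN hd
  have tri : ∀ a b c d e f : ℝ, |a - b| ≤ |a - c| + |b - d| + |c - e| + |d - f| + |e - f| := by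
    intro a b c d e f
    have h1 := abs_sub_le a c b
    have h2 := abs_sub_le c e b
    have h3 := abs_sub_le e f b
    have h4 := abs_sub_le f d b
    rw [abs_sub_comm f d, abs_sub_comm d b] at h4
    linarith
  refine (Finset.sum_le_sum fun k _ => tri _ _ (∫ x, bB N k x * g x ∂uL)
    (∫ x, bB M k x * g x ∂uL) (g (k / N) / (N + 1)) (g (k / M) / (M + 1))).trans ?_
  simp only [Finset.sum_add_distrib]
  linarith

set_option maxHeartbeats 1000000 in
/-- For `s₀ ≥ 1`, the transition distributions
`ν_n({k}) = b·(k/n)·P(I_n = k) + (s₀/n)·1{k = n-s₀}` of the Markov chain associated to the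
random split tree satisfy: there are `ε > 0`, `K > 0` and `n₀` such that for all `n ≥ n₀` and
all `m` with `e^{-K}·n ≤ m ≤ n`, `Σ_k min(ν_n({k}), ν_m({k})) ≥ ε`, i.e. the total variation
distance of `ν_n` and `ν_m` is at most `2(1-ε)`. -/
theorem stmt17
    (b s₀ s₁ : ℕ) (hb : 2 ≤ b) (hs₀ : 1 ≤ s₀)
    {Ω : Type*} [MeasurableSpace Ω] (ℙ : Measure Ω) [IsProbabilityMeasure ℙ]
    (V : Ω → ℝ) (hVmeas : Measurable V)
    (hV01 : ∀ ω, V ω ∈ Set.Icc (0:ℝ) 1)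
    (hVdens : ℙ.map V ≪ (volume : Measure ℝ))
    (hVtail : ∀ x : ℝ, x < 1 → ℙ {ω | V ω ≤ x} < 1)
    (hEV : (∫ ω, V ω ∂ℙ) = 1 / b)
    (I : ℕ → Ω → ℕ) (hImeas : ∀ n, Measurable (I n))
    (hIdist : ∀ n : ℕ, s₀ + b * s₁ ≤ n → ∀ k : ℕ, k ≤ n - s₀ - b * s₁ →
      (ℙ {ω | I n ω = k + s₁}).toReal
        = ∫ ω, ((n - s₀ - b * s₁).choose k : ℝ) * V ω ^ k
            * (1 - V ω) ^ (n - s₀ - b * s₁ - k) ∂ℙ) :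
    ∃ ε : ℝ, 0 < ε ∧ ∃ K : ℝ, 0 < K ∧ ∃ n₀ : ℕ, ∀ n : ℕ, n₀ ≤ n → ∀ m : ℕ,
      Real.exp (-K) * n ≤ m → m ≤ n →
      ε ≤ ∑' k : ℕ, min
        ((b : ℝ) * ((k : ℝ) / n) * (ℙ {ω | I n ω = k}).toReal
          + ((s₀ : ℝ) / n) * (if k = n - s₀ then 1 else 0))
        ((b : ℝ) * ((k : ℝ) / m) * (ℙ {ω | I m ω = k}).toReal
          + ((s₀ : ℝ) / m) * (if k = m - s₀ then 1 else 0)) := by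
  classical
  set μ := ℙ.map V with hμdef
  have : IsProbabilityMeasure μ := Measure.isProbabilityMeasure_map hVmeas.aemeasurable
  have hμ : ∀ᵐ x ∂μ, x ∈ Set.Icc (0:ℝ) 1 := by
    exact (ae_map_iff (p := fun x => x ∈ Set.Icc (0:ℝ) 1) hVmeas.aemeasurable
      measurableSet_Icc).2 (Eventually.of_forall hV01)
  have hbpos : (0:ℝ) < b := by exact_mod_cast (by omega : 0 < b)
  obtain ⟨δ, hδ, N₀, hcore⟩ := core μ hμ hVdens (show (0:ℝ) < 1 / (4 * b) by positivity)
  have hone : Integrable (fun _ : ℝ => (1:ℝ)) μ := integrable_const _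
  have hbi : ∀ N k, Integrable (fun x => bB N k x) μ := fun N k => by
    simpa using bB_mul_integrable N k hμ hone
  -- the distribution of `I n`
  have hI : ∀ n, s₀ + b * s₁ ≤ n → ∀ k ≤ n - s₀ - b * s₁,
      (ℙ {ω | I n ω = k + s₁}).toReal = ∫ x, bB (n - s₀ - b * s₁) k x ∂μ := by
    intro n hn k hk
    rw [hIdist n hn k hk, hμdef, integral_map hVmeas.aemeasurable
      (bB_cont _ _).aestronglyMeasurable]
    simp_rw [bB_eq]
  have hsum1 : ∀ N : ℕ, ∑ k ∈ Finset.range (N + 1), ∫ x, bB N k x ∂μ = 1 := by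
    intro N
    rw [← integral_finsetSum _ fun k _ => hbi N k]
    simp_rw [bB_sum]
    simp
  have hmeanV : ∫ x, x ∂μ = 1 / b := by
    rw [hμdef, integral_map hVmeas.aemeasurable (by fun_prop), hEV]
  have hmean : ∀ N : ℕ, ∑ k ∈ Finset.range (N + 1), (k:ℝ) * ∫ x, bB N k x ∂μ = N / b := by
    intro N
    simp_rw [← integral_const_mul]
    rw [← integral_finsetSum _ fun k _ => (hbi N k).const_mul _]
    simp_rw [bB_mean]
    rw [integral_const_mul, hmeanV]
    ring
  have hzero : ∀ n, s₀ + b * s₁ ≤ n → ∀ j, j ∉ (Finset.range (n - s₀ - b * s₁ + 1)).image (· + s₁) →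
      (ℙ {ω | I n ω = j}).toReal = 0 := by
    intro n hn j hj
    have h1 := sum_measure_preimage_singleton (μ := ℙ) (f := I n)
      (insert j ((Finset.range (n - s₀ - b * s₁ + 1)).image (· + s₁)))
      (fun y _ => hImeas n (measurableSet_singleton y))
    have h2 := congrArg ENNReal.toReal h1
    rw [Finset.sum_insert hj, Finset.sum_image (by intro a _ c _ h; simpa using h),
      ENNReal.toReal_add (measure_ne_top _ _) (ENNReal.sum_ne_top.2 fun _ _ => measure_ne_top _ _),
      ENNReal.toReal_sum fun _ _ => measure_ne_top _ _] at h2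
    have h3 : ∑ k ∈ Finset.range (n - s₀ - b * s₁ + 1), (ℙ (I n ⁻¹' {k + s₁})).toReal = 1 := by
      rw [← hsum1 (n - s₀ - b * s₁)]
      refine Finset.sum_congr rfl fun k hk => ?_
      exact hI n hn k (by simpa [Nat.lt_succ_iff] using hk)
    have h4 : (ℙ (I n ⁻¹' ((insert j ((Finset.range (n - s₀ - b * s₁ + 1)).image (· + s₁)) :
        Finset ℕ) : Set ℕ))).toReal ≤ 1 := by
      exact measureReal_le_one
    have h5 : 0 ≤ (ℙ (I n ⁻¹' {j})).toReal := ENNReal.toReal_nonneg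
    change (ℙ (I n ⁻¹' {j})).toReal = 0
    linarith
  -- choose the parameters
  set τ : ℝ := min (δ / 2) (1 / 8) with hτ
  have hτ0 : 0 < τ := by positivity
  have hτ1 : τ ≤ 1 / 8 := min_le_right _ _
  have hτ2 : τ ≤ δ / 2 := min_le_left _ _
  refine ⟨1 / 4, by norm_num, -Real.log (1 - τ), ?_, 2 * (N₀ + s₀ + b * s₁) + 8 * s₀ + 1, ?_⟩
  · have := Real.log_neg (show 0 < 1 - τ by linarith) (by linarith)
    linarith
  intro n hn m hm hmn
  rw [neg_neg, Real.exp_log (by linarith)] at hm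
  have hmn' : (m:ℝ) ≤ n := by exact_mod_cast hmn
  have hn' : (2:ℝ) * (N₀ + s₀ + b * s₁) + 8 * s₀ + 1 ≤ n := by exact_mod_cast hn
  have hs0' : (0:ℝ) ≤ s₀ := by positivity
  have hNc : (0:ℝ) ≤ N₀ + s₀ + b * s₁ := by positivity
  have hm2 : N₀ + s₀ + b * s₁ ≤ m := by
    have : ((N₀ + s₀ + b * s₁ : ℕ):ℝ) ≤ m := by push_cast; nlinarith
    exact_mod_cast this
  have hmpos : (0:ℝ) < m := by nlinarith
  have hnpos : (0:ℝ) < n := by linarith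
  set M := m - s₀ - b * s₁ with hMdef
  set N := n - s₀ - b * s₁ with hNdef
  have hMm : M + s₀ + b * s₁ = m := by omega
  have hNn : N + s₀ + b * s₁ = n := by omega
  have hMm' : (M:ℝ) + s₀ + b * s₁ = m := by exact_mod_cast hMm
  have hNn' : (N:ℝ) + s₀ + b * s₁ = n := by exact_mod_cast hNn
  have hTV := hcore M N (by omega) (by omega) (by
    have h1 : (N:ℝ) - M = n - m := by linarith
    have h2 : (n:ℝ) / 2 ≤ N := by
      have : (0:ℝ) ≤ N₀ := by positivity
      linarith
    rw [h1]
    nlinarith)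
  set F : ℕ → ℝ := fun k => min
        ((b : ℝ) * ((k : ℝ) / n) * (ℙ {ω | I n ω = k}).toReal
          + ((s₀ : ℝ) / n) * (if k = n - s₀ then 1 else 0))
        ((b : ℝ) * ((k : ℝ) / m) * (ℙ {ω | I m ω = k}).toReal
          + ((s₀ : ℝ) / m) * (if k = m - s₀ then 1 else 0)) with hF
  have hind : ∀ k l : ℕ, (0:ℝ) ≤ if k = l then 1 else 0 := by
    intro k l; split_ifs <;> norm_num
  have hF0 : ∀ k, 0 ≤ F k := by
    intro k
    refine le_min ?_ ?_
    · have := hind k (n - s₀)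
      positivity
    · have := hind k (m - s₀)
      positivity
  have hFs : Summable F := by
    refine summable_of_ne_finset_zero
      (s := insert (n - s₀) ((Finset.range (N + 1)).image (· + s₁))) fun k hk => ?_
    rw [Finset.mem_insert, not_or] at hk
    refine le_antisymm ?_ (hF0 k)
    refine (min_le_left _ _).trans (le_of_eq ?_)
    rw [hzero n (by omega) k hk.2, if_neg hk.1]
    ring
  have hle : ∑ k ∈ Finset.range (M + 1), F (k + s₁) ≤ ∑' k, F k := by
    have := hFs.sum_le_tsum ((Finset.range (M + 1)).image (· + s₁)) (fun k _ => hF0 k)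
    rwa [Finset.sum_image (by intro a _ c _ h; simpa using h)] at this
  refine le_trans ?_ hle
  have hterm : ∀ k ∈ Finset.range (M + 1),
      b / n * (k * (∫ x, bB M k x ∂μ)) + b / n * s₁ * (∫ x, bB M k x ∂μ)
        - b * |(∫ x, bB N k x ∂μ) - ∫ x, bB M k x ∂μ| ≤ F (k + s₁) := by
    intro k hk
    have hkM : k ≤ M := by simpa [Nat.lt_succ_iff] using hk
    have e1 := hI n (by omega) k (by omega)
    have e2 := hI m (by omega) k (by omega)
    rw [← hNdef] at e1
    rw [← hMdef] at e2
    set p := ∫ x, bB N k x ∂μ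
    set q := ∫ x, bB M k x ∂μ
    have hp : 0 ≤ p := e1 ▸ ENNReal.toReal_nonneg
    have hq : 0 ≤ q := e2 ▸ ENNReal.toReal_nonneg
    have hks : (k:ℝ) + s₁ ≤ n := by
      have : k + s₁ ≤ n := by nlinarith
      exact_mod_cast this
    have hc0 : 0 ≤ ((k:ℝ) + s₁) / n := by positivity
    have hc1 : ((k:ℝ) + s₁) / n ≤ 1 := by rw [div_le_one hnpos]; exact hks
    have hcm : ((k:ℝ) + s₁) / n ≤ ((k:ℝ) + s₁) / m := by gcongr
    have hl : b / n * (k * q) + b / n * s₁ * q = b * (((k:ℝ) + s₁) / n) * q := by ring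
    rw [hl]
    refine le_min ?_ ?_
    · have h0 := hind (k + s₁) (n - s₀)
      have h00 : 0 ≤ ((s₀ : ℝ) / n) * (if k + s₁ = n - s₀ then 1 else 0) := by positivity
      rw [e1]
      push_cast
      have h1 : q - p ≤ |p - q| := by rw [abs_sub_comm]; exact le_abs_self _
      have h2 : (((k:ℝ) + s₁) / n) * (q - p) ≤ |p - q| := by
        calc _ ≤ (((k:ℝ) + s₁) / n) * |p - q| := by gcongr
          _ ≤ 1 * |p - q| := by gcongr
          _ = _ := one_mul _
      have h3 := mul_le_mul_of_nonneg_left h2 hbpos.le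
      linarith
    · have h0 := hind (k + s₁) (m - s₀)
      have h00 : 0 ≤ ((s₀ : ℝ) / m) * (if k + s₁ = m - s₀ then 1 else 0) := by positivity
      rw [e2]
      push_cast
      have h1 : 0 ≤ b * |p - q| := by positivity
      have h2 : b * (((k:ℝ) + s₁) / n) * q ≤ b * (((k:ℝ) + s₁) / m) * q := by gcongr
      linarith
  refine le_trans ?_ (Finset.sum_le_sum hterm)
  rw [Finset.sum_sub_distrib, Finset.sum_add_distrib, ← Finset.mul_sum, ← Finset.mul_sum,
    ← Finset.mul_sum, hmean, hsum1]
  have h1 : (b:ℝ) / n * (M / b) + b / n * s₁ * 1 = (m - s₀) / n := by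
    rw [← hMm']; field_simp; ring
  have h2 : (b:ℝ) * ∑ k ∈ Finset.range (M + 1), |(∫ x, bB N k x ∂μ) - ∫ x, bB M k x ∂μ|
      ≤ 1 / 4 := by
    refine (mul_le_mul_of_nonneg_left hTV hbpos.le).trans (le_of_eq ?_)
    field_simp
  have h3 : (1:ℝ) / 2 ≤ (m - s₀) / n := by
    rw [le_div_iff₀ hnpos]
    have h4 : 7 / 8 * (n:ℝ) ≤ (1 - τ) * n := by gcongr; linarith
    linarith
  rw [h1]
  linarith
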